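/- Let α be a type-B composition of n and define ι(π) = π ∘ ω_{o;α} (i.e., ι(π)(a) = π(ω_{o;α}(a))). Then ι maps H_α into H_α, and for all π, π' ∈ H_α one has Inv(π) ⊆ Inv(π') if and only if Inv(ι(π')) ⊆ Inv(ι(π)); that is, ι is an order-reversing involution of the weak order on H_α. -/

import Mathlib

namespace TypeB

/-- A sign-symmetric permutation of degree `n`: a bijection of `ℤ` with
`π(-i) = -π(i)` which fixes every integer of absolute value `> n`.
It restricts to a sign-symmetric permutation of `±[n]`. -/
structure SignedPerm (n : ℕ) where
  perm : Equiv.Perm ℤ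
  sign_symm : ∀ i : ℤ, perm (-i) = - perm i
  outside : ∀ i : ℤ, (n : ℤ) < |i| → perm i = i

/-- Symbols for type-B inversions: `neg i` is `[i]`, `pair i j` (with `i < j`)
is `(i,j)`, and `mixed i j` (with `i < j`) is `(−j, i)`. -/
inductive BInv (n : ℕ) : Type where
  | neg : ℕ → BInv n
  | pair : ℕ → ℕ → BInv n
  | mixed : ℕ → ℕ → BInv n
deriving DecidableEq

/-- `i⁺`: `i+1` if `i ≠ -1`, and `1` for `i = -1`. -/
def iplus (i : ℤ) : ℤ := if i = -1 then 1 else i + 1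

/-- The inversion set of a sign-symmetric permutation. -/
def Inv {n : ℕ} (π : SignedPerm n) : Set (BInv n) := fun t =>
  match t with
  | .neg i => 1 ≤ i ∧ i ≤ n ∧ π.perm (i : ℤ) < 0
  | .pair i j => 1 ≤ i ∧ i < j ∧ j ≤ n ∧ π.perm (j : ℤ) < π.perm (i : ℤ)
  | .mixed i j => 1 ≤ i ∧ i < j ∧ j ≤ n ∧ π.perm (i : ℤ) + π.perm (j : ℤ) < 0

/-- The cover-inversion set of a sign-symmetric permutation. -/
def Cov {n : ℕ} (π : SignedPerm n) : Set (BInv n) := fun t =>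
  match t with
  | .neg i => 1 ≤ i ∧ i ≤ n ∧ π.perm (i : ℤ) = -1
  | .pair i j => 1 ≤ i ∧ i < j ∧ j ≤ n ∧ π.perm (i : ℤ) = iplus (π.perm (j : ℤ))
  | .mixed i j => 1 ≤ i ∧ i < j ∧ j ≤ n ∧ π.perm (-(j : ℤ)) = iplus (π.perm (i : ℤ))

/-- The symbol `(−j, i)` in canonical form (it equals `(−i, j)`). -/
def mixedInv {n : ℕ} (i j : ℕ) : BInv n := .mixed (min i j) (max i j)

/-- A type-B composition of `n`: positive parts summing to `n`,
together with a split/join label. -/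
structure BComp (n : ℕ) where
  parts : List ℕ
  pos : ∀ a ∈ parts, 0 < a
  sum_eq : parts.sum = n
  isJoin : Bool

/-- The partial sum `p_i = α₁ + ⋯ + α_i`. -/
def pSum {n : ℕ} (α : BComp n) (i : ℕ) : ℕ := (α.parts.take i).sum

/-- The α-region of `a ∈ [n]`: the unique `i` with `p_{i-1} < a ≤ p_i`. -/
def region {n : ℕ} (α : BComp n) (a : ℕ) : ℕ :=
  ((Finset.range α.parts.length).filter (fun j => pSum α j < a)).card

/-- The first part `α₁` of a type-B composition. -/
def alpha1 {n : ℕ} (α : BComp n) : ℕ := α.parts.headI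

/-- Index of the block of `Part(α)` containing `x ∈ ±[n]`; two elements lie in
a common block of `Part(α)` iff their indices agree. -/
def blockIdx {n : ℕ} (α : BComp n) (x : ℤ) : ℤ :=
  if 0 < x then
    (if α.isJoin = true ∧ region α x.toNat = 1 then 0 else (region α x.toNat : ℤ))
  else
    (if α.isJoin = true ∧ region α (-x).toNat = 1 then 0 else -(region α (-x).toNat : ℤ))

/-- Membership in `±[n]`. -/
def inPM (n : ℕ) (x : ℤ) : Prop := x ≠ 0 ∧ -(n : ℤ) ≤ x ∧ x ≤ (n : ℤ)

/-- `π ∈ H_α`: `π` is increasing on every block of `Part(α)`. -/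
def memH {n : ℕ} (α : BComp n) (π : SignedPerm n) : Prop :=
  ∀ a b : ℤ, inPM n a → inPM n b → a < b → blockIdx α a = blockIdx α b →
    π.perm a < π.perm b

/-- Common part of the type-B `(α,231)`- and `(α,312)`-patterns: indices
`i < j < k` in `±[n]`, in pairwise distinct blocks of `Part(α)`, with `j > 0`
and `π(i) = π(k)⁺`. -/
def patternCore {n : ℕ} (α : BComp n) (π : SignedPerm n) (i j k : ℤ) : Prop :=
  inPM n i ∧ inPM n j ∧ inPM n k ∧ i < j ∧ j < k ∧ 0 < j ∧
  blockIdx α i ≠ blockIdx α j ∧ blockIdx α j ≠ blockIdx α k ∧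
  blockIdx α i ≠ blockIdx α k ∧ π.perm i = iplus (π.perm k)

/-- `π` has a type-B `(α,231)`-split (resp. -join) pattern, according to the
label of `α`. -/
def has231 {n : ℕ} (α : BComp n) (π : SignedPerm n) : Prop :=
  ∃ i j k : ℤ, patternCore α π i j k ∧
    (if α.isJoin = true then
       (((alpha1 α : ℤ) < j → π.perm i < π.perm j) ∧
        (j ≤ (alpha1 α : ℤ) → π.perm j < π.perm k))
     else π.perm i < π.perm j)

/-- `π` has a type-B `(α,312)`-split (resp. -join) pattern, according to the
label of `α`. -/
def has312 {n : ℕ} (α : BComp n) (π : SignedPerm n) : Prop :=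
  ∃ i j k : ℤ, patternCore α π i j k ∧
    (if α.isJoin = true then
       (((alpha1 α : ℤ) < j → π.perm j < π.perm k) ∧
        (j ≤ (alpha1 α : ℤ) → π.perm i < π.perm j))
     else π.perm j < π.perm k)

/-- `π ∈ H_α(231)`. -/
def mem231 {n : ℕ} (α : BComp n) (π : SignedPerm n) : Prop := memH α π ∧ ¬ has231 α π

/-- `π ∈ H_α(312)`. -/
def mem312 {n : ℕ} (α : BComp n) (π : SignedPerm n) : Prop := memH α π ∧ ¬ has312 α π

/-- The set `H_α`. -/
def Hset {n : ℕ} (α : BComp n) : Set (SignedPerm n) := {π | memH α π}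

/-- The carrier of `Tam_B(α)`, namely `H_α(231)`. -/
def Tset {n : ℕ} (α : BComp n) : Set (SignedPerm n) := {π | mem231 α π}

/-- The weak order: inclusion of inversion sets. -/
def wle {n : ℕ} (π σ : SignedPerm n) : Prop := Inv π ⊆ Inv σ

/-- `m` is the greatest lower bound of `x` and `y` within `P`, w.r.t. the weak order. -/
def isMeetIn {n : ℕ} (P : Set (SignedPerm n)) (x y m : SignedPerm n) : Prop :=
  m ∈ P ∧ wle m x ∧ wle m y ∧ ∀ z ∈ P, wle z x → wle z y → wle z m

/-- `u` is the least upper bound of `x` and `y` within `P`, w.r.t. the weak order. -/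
def isJoinIn {n : ℕ} (P : Set (SignedPerm n)) (x y u : SignedPerm n) : Prop :=
  u ∈ P ∧ wle x u ∧ wle y u ∧ ∀ z ∈ P, wle x z → wle y z → wle u z

/-- `d = Π↓(π)`: `d` is the greatest element of `{σ ∈ H_α(231) : Inv σ ⊆ Inv π}`. -/
def isProjDown {n : ℕ} (α : BComp n) (π d : SignedPerm n) : Prop :=
  mem231 α d ∧ wle d π ∧ ∀ σ, mem231 α σ → wle σ π → wle σ d

/-- `d = Π†(π)`: `d` is the greatest element of `{σ ∈ H_α(312) : Inv σ ⊆ Inv π}`. -/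
def isProjDagger {n : ℕ} (α : BComp n) (π d : SignedPerm n) : Prop :=
  mem312 α d ∧ wle d π ∧ ∀ σ, mem312 α σ → wle σ π → wle σ d

/-- The value `ω_{o;α}(a)` for `a ∈ [n]`. -/
def omegaPos {n : ℕ} (α : BComp n) (a : ℕ) : ℤ :=
  if α.isJoin = true ∧ region α a = 1 then (a : ℤ)
  else -(((pSum α (region α a) : ℤ) + (pSum α (region α a - 1) : ℤ) + 1) - (a : ℤ))

/-- The longest element `ω_{o;α}` of `H_α`, as a function on `ℤ`. -/
def omegaFun {n : ℕ} (α : BComp n) (x : ℤ) : ℤ :=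
  if 0 < x ∧ x ≤ (n : ℤ) then omegaPos α x.toNat
  else if 0 < -x ∧ -x ≤ (n : ℤ) then -(omegaPos α (-x).toNat)
  else x

/-- The set of `m` such that there is a strict chain `x₀ < x₁ < ⋯ < x_m` in `P`. -/
def chainLengths {n : ℕ} (P : Set (SignedPerm n)) : Set ℕ :=
  {m | ∃ f : Fin (m + 1) → SignedPerm n, (∀ i, f i ∈ P) ∧
        ∀ i j : Fin (m + 1), i < j → Inv (f i) ⊂ Inv (f j)}

/-- `x` is join-irreducible in `Tam_B(α)`. -/
def joinIrred {n : ℕ} (α : BComp n) (x : SignedPerm n) : Prop :=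
  x ∈ Tset α ∧ ¬ (∀ y ∈ Tset α, wle x y) ∧
  ∀ y z, y ∈ Tset α → z ∈ Tset α → isJoinIn (Tset α) y z x → x = y ∨ x = z

/-- `x` is meet-irreducible in `Tam_B(α)`. -/
def meetIrred {n : ℕ} (α : BComp n) (x : SignedPerm n) : Prop :=
  x ∈ Tset α ∧ ¬ (∀ y ∈ Tset α, wle y x) ∧
  ∀ y z, y ∈ Tset α → z ∈ Tset α → isMeetIn (Tset α) y z x → x = y ∨ x = z

/-- `x` is left modular in the lattice on `P`: `(r ∨ x) ∧ q = r ∨ (x ∧ q)`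
for all `r ≤ q` in `P`. -/
def leftModular {n : ℕ} (P : Set (SignedPerm n)) (x : SignedPerm n) : Prop :=
  ∀ r q, r ∈ P → q ∈ P → wle r q →
    ∀ u v w1 w2, isJoinIn P r x u → isMeetIn P u q v →
      isMeetIn P x q w1 → isJoinIn P r w1 w2 → v = w2

/-- The simple generator `s_i` as a function on `ℤ`: `s₀` exchanges `1` and `-1`,
and for `i ≥ 1`, `s_i` exchanges `i` with `i+1` and `-i` with `-(i+1)`. -/
def sfun (i : ℕ) (x : ℤ) : ℤ :=
  if i = 0 then (if x = 1 then -1 else if x = -1 then 1 else x)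
  else if x = (i : ℤ) then (i : ℤ) + 1
  else if x = (i : ℤ) + 1 then (i : ℤ)
  else if x = -(i : ℤ) then -(i : ℤ) - 1
  else if x = -(i : ℤ) - 1 then -(i : ℤ)
  else x

/-- `i` is one of the partial sums `p₁, …, p_{r−1}` of `α`. -/
def isPSum {n : ℕ} (α : BComp n) (i : ℕ) : Prop :=
  ∃ j : ℕ, 1 ≤ j ∧ j < α.parts.length ∧ pSum α j = i

/-- `n² − Σᵢ α_i(α_i−1)/2`, minus additionally `(α₁+1)α₁/2` when `α` is join. -/
def lengthFormula {n : ℕ} (α : BComp n) : ℕ :=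
  n ^ 2 - (α.parts.map (fun a => a * (a - 1) / 2)).sum -
    (if α.isJoin = true then (alpha1 α + 1) * alpha1 α / 2 else 0)

theorem pSum_mono {n : ℕ} (α : BComp n) : Monotone (pSum α) := by
  refine monotone_nat_of_le_succ fun k => ?_
  unfold pSum
  by_cases hk : k < α.parts.length
  · rw [List.sum_take_succ _ _ hk]
    omega
  · rw [List.take_of_length_le (by omega), List.take_of_length_le (by omega)]

theorem region_eq {n : ℕ} (α : BComp n) {a r : ℕ} (hr : 1 ≤ r) (hlen : r ≤ α.parts.length)
    (hlo : pSum α (r - 1) < a) (hhi : a ≤ pSum α r) : region α a = r := by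
  have h : (Finset.range α.parts.length).filter (fun j => pSum α j < a) = Finset.range r := by
    ext j
    simp only [Finset.mem_filter, Finset.mem_range]
    constructor
    · rintro ⟨-, hj⟩
      by_contra hrj
      have := pSum_mono α (not_lt.mp hrj)
      omega
    · intro hj
      have := pSum_mono α (show j ≤ r - 1 by omega)
      omega
  rw [region, h, Finset.card_range]

theorem region_spec {n : ℕ} (α : BComp n) {a : ℕ} (ha : 0 < a) (han : a ≤ n) :
    1 ≤ region α a ∧ region α a ≤ α.parts.length ∧
      pSum α (region α a - 1) < a ∧ a ≤ pSum α (region α a) := by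
  have hlast : a ≤ pSum α α.parts.length := by
    rw [pSum, List.take_length, α.sum_eq]
    exact han
  have hex : ∃ r, a ≤ pSum α r := ⟨_, hlast⟩
  have hzero : pSum α 0 = 0 := by simp [pSum]
  have hhi := Nat.find_spec hex
  have hpos : 1 ≤ Nat.find hex := by
    by_contra h
    rw [show Nat.find hex = 0 by omega] at hhi
    omega
  have hlen : Nat.find hex ≤ α.parts.length := Nat.find_min' hex hlast
  have hlo : pSum α (Nat.find hex - 1) < a :=
    not_le.mp (Nat.find_min hex (show Nat.find hex - 1 < Nat.find hex by omega))
  rw [region_eq α hpos hlen hlo hhi]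
  exact ⟨hpos, hlen, hlo, hhi⟩

theorem region_reflect {n : ℕ} (α : BComp n) {a : ℕ} (ha : 0 < a) (han : a ≤ n) :
    region α (pSum α (region α a) + pSum α (region α a - 1) + 1 - a) = region α a := by
  obtain ⟨h1, h2, h3, h4⟩ := region_spec α ha han
  exact region_eq α h1 h2 (by omega) (by omega)

theorem region_mono {n : ℕ} (α : BComp n) : Monotone (region α) := by
  intro a b hab
  refine Finset.card_le_card fun j => ?_
  simp only [Finset.mem_filter]
  exact fun h => ⟨h.1, h.2.trans_le hab⟩

theorem blockIdx_neg {n : ℕ} (α : BComp n) {x : ℤ} (hx : x ≠ 0) :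
    blockIdx α (-x) = -blockIdx α x := by
  rcases lt_or_gt_of_ne hx with h | h
  · rw [blockIdx, blockIdx, if_pos (show 0 < -x by omega), if_neg (show ¬0 < x by omega)]
    split_ifs <;> simp
  · rw [blockIdx, blockIdx, if_neg (show ¬0 < -x by omega), if_pos h, neg_neg]
    split_ifs <;> simp

theorem blockIdx_nonneg {n : ℕ} (α : BComp n) {x : ℤ} (hx : 0 < x) : 0 ≤ blockIdx α x := by
  rw [blockIdx, if_pos hx]
  split_ifs <;> simp

theorem blockIdx_mono_of_pos {n : ℕ} (α : BComp n) {x y : ℤ} (hx : 0 < x) (hxn : x ≤ n)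
    (hxy : x ≤ y) : blockIdx α x ≤ blockIdx α y := by
  have hr := region_mono α (Int.toNat_le_toNat hxy)
  have h1 := (region_spec α (a := x.toNat) (by omega) (by omega)).1
  rw [blockIdx, blockIdx, if_pos hx, if_pos (hx.trans_le hxy)]
  split_ifs with hjx hjy hjy
  · exact le_rfl
  · omega
  · exact absurd ⟨hjy.1, by omega⟩ hjx
  · omega

theorem blockIdx_mono {n : ℕ} (α : BComp n) {x y : ℤ} (hx : inPM n x) (hy : inPM n y)
    (hxy : x ≤ y) : blockIdx α x ≤ blockIdx α y := by
  obtain ⟨hx0, hx1, hx2⟩ := hx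
  obtain ⟨hy0, hy1, hy2⟩ := hy
  rcases lt_or_gt_of_ne hx0 with h | h
  · have hnx := blockIdx_neg α hx0
    rcases lt_or_gt_of_ne hy0 with h' | h'
    · have hny := blockIdx_neg α hy0
      have := blockIdx_mono_of_pos α (x := -y) (y := -x) (by omega) (by omega) (by omega)
      omega
    · have := blockIdx_nonneg α (x := -x) (by omega)
      have := blockIdx_nonneg α h'
      omega
  · exact blockIdx_mono_of_pos α h hx2 hxy

/-- The constant by which `ω_{o;α}` translates the block of index `k`. -/
def blockShift {n : ℕ} (α : BComp n) (k : ℤ) : ℤ :=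
  -(k.sign * ((pSum α k.natAbs : ℤ) + pSum α (k.natAbs - 1) + 1))

theorem blockShift_neg {n : ℕ} (α : BComp n) (k : ℤ) :
    blockShift α (-k) = -blockShift α k := by
  simp [blockShift]

theorem omegaFun_neg {n : ℕ} (α : BComp n) (x : ℤ) : omegaFun α (-x) = -omegaFun α x := by
  simp only [omegaFun, neg_neg]
  split_ifs <;> omega

theorem omegaFun_spec_of_pos {n : ℕ} (α : BComp n) {x : ℤ} (hx : 0 < x) (hxn : x ≤ n) :
    omegaFun α x = x + blockShift α (blockIdx α x) ∧
      blockIdx α (omegaFun α x) = -blockIdx α x := by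
  lift x to ℕ using hx.le
  have ha : 0 < x := by omega
  have han : x ≤ n := by omega
  obtain ⟨h1, h2, h3, h4⟩ := region_spec α ha han
  have hω : omegaFun α x = omegaPos α x := by
    rw [omegaFun, if_pos ⟨hx, hxn⟩, Int.toNat_natCast]
  by_cases hj : α.isJoin = true ∧ region α x = 1
  · have hb : blockIdx α x = 0 := by
      rw [blockIdx, if_pos hx, Int.toNat_natCast, if_pos hj]
    rw [hω, omegaPos, if_pos hj, hb]
    simp [blockShift]
  · have hb : blockIdx α x = region α x := by
      rw [blockIdx, if_pos hx, Int.toNat_natCast, if_neg hj]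
    have hrefl := region_reflect α ha han
    set y := pSum α (region α x) + pSum α (region α x - 1) + 1 - x with hy
    have hy0 : (0 : ℤ) < y := by omega
    have hωy : omegaFun α x = -(y : ℤ) := by
      rw [hω, omegaPos, if_neg hj]
      omega
    have hby : blockIdx α y = region α x := by
      rw [blockIdx, if_pos hy0, Int.toNat_natCast, hrefl, if_neg hj]
    rw [hωy, blockIdx_neg α hy0.ne', hby, hb]
    refine ⟨?_, rfl⟩
    rw [blockShift, Int.sign_eq_one_of_pos (by omega), Int.natAbs_natCast]
    omega

theorem omegaFun_spec {n : ℕ} (α : BComp n) {x : ℤ} (hx : inPM n x) :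
    omegaFun α x = x + blockShift α (blockIdx α x) ∧
      blockIdx α (omegaFun α x) = -blockIdx α x := by
  obtain ⟨hx0, hx1, hx2⟩ := hx
  rcases lt_or_gt_of_ne hx0 with h | h
  · obtain ⟨h1, h2⟩ := omegaFun_spec_of_pos α (x := -x) (by omega) (by omega)
    have hne : omegaFun α x ≠ 0 := by
      intro h0
      rw [omegaFun_neg, h0, neg_zero, blockIdx_neg α hx0] at h2
      rw [omegaFun_neg, h0, blockIdx_neg α hx0, blockShift_neg] at h1
      have h00 : blockIdx α 0 = 0 := by simp [blockIdx, region]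
      have hb : blockIdx α x = 0 := by omega
      simp [hb, blockShift] at h1
      omega
    rw [omegaFun_neg, blockIdx_neg α hx0, blockShift_neg] at h1
    rw [omegaFun_neg, blockIdx_neg α hne, blockIdx_neg α hx0] at h2
    omega
  · exact omegaFun_spec_of_pos α h hx2

theorem SignedPerm.perm_zero {n : ℕ} (π : SignedPerm n) : π.perm 0 = 0 := by
  have := π.sign_symm 0
  rw [neg_zero] at this
  omega

theorem SignedPerm.inPM_perm {n : ℕ} (π : SignedPerm n) {x : ℤ} (hx : inPM n x) :
    inPM n (π.perm x) := by
  have h0 : π.perm x ≠ 0 := fun h => hx.1 (π.perm.injective (h.trans π.perm_zero.symm))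
  have hle : |π.perm x| ≤ n := by
    by_contra h
    have hfix := π.perm.injective (π.outside _ (not_le.mp h))
    rw [hfix] at h
    exact h (abs_le.mpr hx.2)
  exact ⟨h0, abs_le.mp hle⟩

/-- Inclusion of inversion sets, tested on all pairs in `±[n]`. -/
theorem Inv_subset_iff {n : ℕ} (π σ : SignedPerm n) :
    Inv π ⊆ Inv σ ↔ ∀ x y : ℤ, inPM n x → inPM n y → x < y →
      π.perm y < π.perm x → σ.perm y < σ.perm x := by
  constructor
  · intro h
    have hpair (i j : ℕ) (h1 : 1 ≤ i) (h2 : i < j) (h3 : j ≤ n)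
        (hπ : π.perm j < π.perm i) : σ.perm j < σ.perm i :=
      (h (show BInv.pair i j ∈ Inv π from ⟨h1, h2, h3, hπ⟩)).2.2.2
    have hmixed (i j : ℕ) (h1 : 1 ≤ i) (h2 : i < j) (h3 : j ≤ n)
        (hπ : π.perm i + π.perm j < 0) : σ.perm i + σ.perm j < 0 :=
      (h (show BInv.mixed i j ∈ Inv π from ⟨h1, h2, h3, hπ⟩)).2.2.2
    have hneg (i : ℕ) (h1 : 1 ≤ i) (h2 : i ≤ n) (hπ : π.perm i < 0) : σ.perm i < 0 :=
      (h (show BInv.neg i ∈ Inv π from ⟨h1, h2, hπ⟩)).2.2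
    rintro x y ⟨hx0, hx1, hx2⟩ ⟨hy0, hy1, hy2⟩ hxy hπ
    have hsx (τ : SignedPerm n) := τ.sign_symm x
    have hsy (τ : SignedPerm n) := τ.sign_symm y
    rcases lt_or_gt_of_ne hx0 with hx | hx <;> rcases lt_or_gt_of_ne hy0 with hy | hy
    · have := hpair (-y).toNat (-x).toNat (by omega) (by omega) (by omega)
      rw [Int.toNat_of_nonneg (by omega), Int.toNat_of_nonneg (by omega), hsx, hsy, hsx, hsy]
        at this
      omega
    · rcases lt_trichotomy (-x) y with hlt | heq | hlt
      · have := hmixed (-x).toNat y.toNat (by omega) (by omega) (by omega)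
        rw [Int.toNat_of_nonneg (by omega), Int.toNat_of_nonneg (by omega), hsx, hsx] at this
        omega
      · have := hneg y.toNat (by omega) (by omega)
        rw [Int.toNat_of_nonneg (by omega), ← heq, hsx, hsx] at this
        rw [← heq, hsx] at hπ ⊢
        omega
      · have := hmixed y.toNat (-x).toNat (by omega) (by omega) (by omega)
        rw [Int.toNat_of_nonneg (by omega), Int.toNat_of_nonneg (by omega), hsx, hsx] at this
        omega
    · omega
    · have := hpair x.toNat y.toNat (by omega) (by omega) (by omega)
      rw [Int.toNat_of_nonneg (by omega), Int.toNat_of_nonneg (by omega)] at this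
      exact this hπ
  · rintro h (i | ⟨i, j⟩ | ⟨i, j⟩)
    · rintro ⟨h1, h2, hπ⟩
      have := h (-i) i ⟨by omega, by omega, by omega⟩ ⟨by omega, by omega, by omega⟩ (by omega)
      rw [π.sign_symm, σ.sign_symm] at this
      exact ⟨h1, h2, by omega⟩
    · rintro ⟨h1, h2, h3, hπ⟩
      exact ⟨h1, h2, h3, h i j ⟨by omega, by omega, by omega⟩ ⟨by omega, by omega, by omega⟩
        (by omega) hπ⟩
    · rintro ⟨h1, h2, h3, hπ⟩
      have := h (-j) i ⟨by omega, by omega, by omega⟩ ⟨by omega, by omega, by omega⟩ (by omega)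
      rw [π.sign_symm, σ.sign_symm] at this
      exact ⟨h1, h2, h3, by omega⟩

section LongestElement

variable {n : ℕ} {α : BComp n} {w : SignedPerm n}

theorem blockIdx_longest (hw : ∀ x : ℤ, w.perm x = omegaFun α x) {x : ℤ} (hx : inPM n x) :
    blockIdx α (w.perm x) = -blockIdx α x := by
  rw [hw]
  exact (omegaFun_spec α hx).2

theorem longest_lt_of_blockIdx_eq (hw : ∀ x : ℤ, w.perm x = omegaFun α x) {x y : ℤ}
    (hx : inPM n x) (hy : inPM n y) (hxy : x < y) (hb : blockIdx α x = blockIdx α y) :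
    w.perm x < w.perm y := by
  rw [hw, hw, (omegaFun_spec α hx).1, (omegaFun_spec α hy).1, hb]
  omega

theorem longest_lt_of_blockIdx_ne (hw : ∀ x : ℤ, w.perm x = omegaFun α x) {x y : ℤ}
    (hx : inPM n x) (hy : inPM n y) (hxy : x < y) (hb : blockIdx α x ≠ blockIdx α y) :
    w.perm y < w.perm x := by
  by_contra h
  have h1 := blockIdx_mono α (w.inPM_perm hx) (w.inPM_perm hy) (not_lt.mp h)
  have h2 := blockIdx_mono α hx hy hxy.le
  rw [blockIdx_longest hw hx, blockIdx_longest hw hy] at h1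
  omega

theorem longest_involutive (hw : ∀ x : ℤ, w.perm x = omegaFun α x) (x : ℤ) :
    w.perm (w.perm x) = x := by
  by_cases hx : inPM n x
  · rw [hw (w.perm x), (omegaFun_spec α (w.inPM_perm hx)).1, blockIdx_longest hw hx,
      blockShift_neg, hw, (omegaFun_spec α hx).1]
    omega
  · have hfix : w.perm x = x := by
      by_cases h0 : x = 0
      · rw [h0, w.perm_zero]
      · refine w.outside x (not_le.mp fun h => hx ⟨h0, abs_le.mp h⟩)
    rw [hfix, hfix]

theorem memH_comp_longest (hw : ∀ x : ℤ, w.perm x = omegaFun α x) {π ιπ : SignedPerm n}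
    (hπ : memH α π) (hι : ∀ x : ℤ, ιπ.perm x = π.perm (w.perm x)) : memH α ιπ := by
  intro a b ha hb hab hblk
  rw [hι, hι]
  refine hπ _ _ (w.inPM_perm ha) (w.inPM_perm hb) (longest_lt_of_blockIdx_eq hw ha hb hab hblk) ?_
  rw [blockIdx_longest hw ha, blockIdx_longest hw hb, hblk]

theorem Inv_comp_longest_subset (hw : ∀ x : ℤ, w.perm x = omegaFun α x)
    {π π' ιπ ιπ' : SignedPerm n} (hπ' : memH α π')
    (hι : ∀ x : ℤ, ιπ.perm x = π.perm (w.perm x))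
    (hι' : ∀ x : ℤ, ιπ'.perm x = π'.perm (w.perm x)) (h : Inv π ⊆ Inv π') :
    Inv ιπ' ⊆ Inv ιπ := by
  rw [Inv_subset_iff] at h ⊢
  intro x y hx hy hxy hinv
  have hb : blockIdx α x ≠ blockIdx α y := fun hb =>
    (memH_comp_longest hw hπ' hι' x y hx hy hxy hb).asymm hinv
  have hlt := longest_lt_of_blockIdx_ne hw hx hy hxy hb
  by_contra hcon
  have hne : ιπ.perm x ≠ ιπ.perm y := fun he => hxy.ne (ιπ.perm.injective he)
  have hlt' : ιπ.perm x < ιπ.perm y := lt_of_le_of_ne (not_lt.mp hcon) hne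
  rw [hι, hι] at hlt'
  rw [hι', hι'] at hinv
  exact (h _ _ (w.inPM_perm hy) (w.inPM_perm hx) hlt hlt').asymm hinv

end LongestElement

/-- The map `ι(π) = π ∘ ω_{o;α}` maps `H_α` into `H_α`, and
for all `π, π' ∈ H_α` one has `Inv(π) ⊆ Inv(π')` iff
`Inv(ι(π')) ⊆ Inv(ι(π))`: `ι` is order-reversing on the weak order on `H_α`. -/
theorem iota_order_reversing (n : ℕ) (hn : 1 ≤ n) (α : BComp n)
    (w : SignedPerm n) (hw : ∀ x : ℤ, w.perm x = omegaFun α x) :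
    (∀ π ιπ : SignedPerm n, memH α π →
        (∀ x : ℤ, ιπ.perm x = π.perm (w.perm x)) → memH α ιπ) ∧
    (∀ π π' ιπ ιπ' : SignedPerm n, memH α π → memH α π' →
        (∀ x : ℤ, ιπ.perm x = π.perm (w.perm x)) →
        (∀ x : ℤ, ιπ'.perm x = π'.perm (w.perm x)) →
        (Inv π ⊆ Inv π' ↔ Inv ιπ' ⊆ Inv ιπ)) := by
  refine ⟨fun π ιπ hπ hι => memH_comp_longest hw hπ hι,
    fun π π' ιπ ιπ' hπ hπ' hι hι' => ⟨Inv_comp_longest_subset hw hπ' hι hι', fun h => ?_⟩⟩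
  refine Inv_comp_longest_subset hw (memH_comp_longest hw hπ hι) (fun x => ?_) (fun x => ?_) h
  · rw [hι', longest_involutive hw]
  · rw [hι, longest_involutive hw]

end TypeB
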